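/- arXiv:2102.06295 — 2 statements merged into one kernel-verified Lean document; each statement's English description precedes it below -/
import Mathlib

section
/- Let d ≥ 1 and let G = (V, E) be a finite simple graph. If G admits some configuration p₀ : V → ℝ^d such that the framework (G, p₀) is infinitesimally rigid, then for every generic configuration q : V → ℝ^d the framework (G, q) is infinitesimally rigid. (Infinitesimal rigidity is a generic property: all generic realizations of the underlying graph are infinitesimally rigid.) -/
noncomputable section

/-- A configuration `p : V → ℝ^d` is generic if the `d|V|` coordinates of the points
are algebraically independent over ℚ. -/
def IsGenericConfig {V : Type*} (d : ℕ) (p : V → EuclideanSpace ℝ (Fin d)) : Prop :=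
  AlgebraicIndependent ℚ (fun vi : V × Fin d => p vi.1 vi.2)

/-- The rigidity matrix of the framework `(G, p)` in ℝ^d: one row per edge, `d` columns
per vertex; the row of an edge `{u, v}` contains `p u - p v` in the columns of `u`,
`p v - p u` in the columns of `v`, and zeros elsewhere. -/
def rigidityMatrix {V : Type*} [DecidableEq V] {d : ℕ} (G : SimpleGraph V)
    (p : V → EuclideanSpace ℝ (Fin d)) : Matrix G.edgeSet (V × Fin d) ℝ :=
  fun e vi =>
    if h : vi.1 ∈ (e : Sym2 V) then (p vi.1 - p (Sym2.Mem.other h)) vi.2 else 0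

/-- `(G, p)` is infinitesimally rigid in ℝ^d if `p(V)` affinely spans ℝ^d and the
rigidity matrix has rank `d|V| - d(d+1)/2`. -/
def InfinitesimallyRigid {V : Type*} [Fintype V] [DecidableEq V] {d : ℕ}
    (G : SimpleGraph V) [DecidableRel G.Adj] (p : V → EuclideanSpace ℝ (Fin d)) : Prop :=
  affineSpan ℝ (Set.range p) = ⊤ ∧
  (rigidityMatrix G p).rank = d * Fintype.card V - d * (d + 1) / 2

theorem Matrix.exists_linearIndependent_cols {m n K : Type*} [Fintype n] [Field K]
    (A : Matrix m n K) {k : ℕ} (hk : A.rank = k) :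
    ∃ c : Fin k → n, LinearIndependent K (A.submatrix id c).col := by
  subst hk
  rw [Matrix.rank_eq_finrank_span_cols]
  have := FiniteDimensional.span_of_finite K (Set.finite_range A.col)
  obtain ⟨f, hf, -, hli⟩ := Submodule.exists_fun_fin_finrank_span_eq K (Set.range A.col)
  choose c hc using hf
  exact ⟨c, by rwa [← funext hc] at hli⟩

open Matrix in
theorem Matrix.exists_submatrix_det_ne_zero {m n K : Type*} [Fintype m] [Fintype n] [Field K]
    (A : Matrix m n K) :
    ∃ (r : Fin A.rank → m) (c : Fin A.rank → n), (A.submatrix r c).det ≠ 0 := by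
  obtain ⟨c, hc⟩ := A.exists_linearIndependent_cols rfl
  have hrank : (A.submatrix id c)ᵀ.rank = A.rank := by
    simpa using LinearIndependent.rank_matrix (M := (A.submatrix id c)ᵀ) hc
  obtain ⟨r, hr⟩ := (A.submatrix id c)ᵀ.exists_linearIndependent_cols hrank
  refine ⟨r, c, ?_⟩
  rw [← isUnit_iff_ne_zero, ← Matrix.isUnit_iff_isUnit_det,
    ← Matrix.linearIndependent_rows_iff_isUnit]
  exact hr

open MvPolynomial in
theorem Matrix.rank_map_aeval_le_of_algebraicIndependent {m n σ R K : Type*} [Fintype m] [Fintype n]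
    [CommRing R] [Field K] [Algebra R K] (M : Matrix m n (MvPolynomial σ R)) {x : σ → K}
    (hx : AlgebraicIndependent R x) (y : σ → K) :
    (M.map (aeval y)).rank ≤ (M.map (aeval x)).rank := by
  obtain ⟨r, c, h⟩ := (M.map (aeval y)).exists_submatrix_det_ne_zero
  have key (z : σ → K) : ((M.map (aeval z)).submatrix r c).det = aeval z (M.submatrix r c).det := by
    rw [AlgHom.map_det]
    rfl
  have hdet : ((M.map (aeval x)).submatrix r c).det ≠ 0 := by
    rw [key] at h ⊢
    intro h0
    apply h
    rw [(injective_iff_map_eq_zero _).1 hx _ h0, map_zero]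
  simpa [Matrix.rank_of_det_ne_zero hdet] using rank_submatrix_le (M.map (aeval x)) r c

/-- The matrix whose rows are the homogeneous coordinates of the points `p v`. -/
def homogeneousMatrix {V : Type*} {d : ℕ} (p : V → EuclideanSpace ℝ (Fin d)) :
    Matrix V (Option (Fin d)) ℝ :=
  fun v o => o.elim 1 (p v)

theorem eq_zero_of_sum_add_eq_zero_of_affineSpan_eq_top {V : Type*} {d : ℕ}
    {p : V → EuclideanSpace ℝ (Fin d)} (hp : affineSpan ℝ (Set.range p) = ⊤)
    {a : Fin d → ℝ} {b : ℝ} (h : ∀ v, ∑ i, a i * p v i + b = 0) : a = 0 ∧ b = 0 := by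
  let f : EuclideanSpace ℝ (Fin d) →ᵃ[ℝ] ℝ :=
    (Fintype.linearCombination ℝ a ∘ₗ
      (EuclideanSpace.equiv (Fin d) ℝ).toLinearMap).toAffineMap + AffineMap.const ℝ _ b
  have hf (x : EuclideanSpace ℝ (Fin d)) : f x = ∑ i, a i * x i + b := by
    simp [f, Fintype.linearCombination_apply, mul_comm]
  have h0 : f = AffineMap.const ℝ _ 0 := by
    apply AffineMap.ext_on hp
    rintro _ ⟨v, rfl⟩
    simpa [hf] using h v
  have h1 (x : EuclideanSpace ℝ (Fin d)) : ∑ i, a i * x i + b = 0 := by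
    rw [← hf, h0]; rfl
  have hb : b = 0 := by simpa using h1 0
  refine ⟨funext fun i => ?_, hb⟩
  simpa [hb] using h1 (EuclideanSpace.single i 1)

theorem rank_homogeneousMatrix_eq_iff {V : Type*} [Fintype V] {d : ℕ}
    (p : V → EuclideanSpace ℝ (Fin d)) :
    (homogeneousMatrix p).rank = d + 1 ↔ affineSpan ℝ (Set.range p) = ⊤ := by
  have hmul (c : Option (Fin d) → ℝ) (v : V) :
      (homogeneousMatrix p).mulVecLin c v = ∑ i, c (some i) * p v i + c none := by
    simp [homogeneousMatrix, Matrix.mulVec, dotProduct, Fintype.sum_option, add_comm, mul_comm]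
  have hker : (homogeneousMatrix p).rank = d + 1 ↔
      LinearMap.ker (homogeneousMatrix p).mulVecLin = ⊥ := by
    have := (homogeneousMatrix p).mulVecLin.finrank_range_add_finrank_ker
    rw [← Submodule.finrank_eq_zero (R := ℝ), Matrix.rank]
    simp at this
    omega
  rw [hker, LinearMap.ker_eq_bot']
  constructor
  · intro h
    have hne : (Set.range p).Nonempty := by
      by_contra hne
      rw [Set.range_nonempty_iff_nonempty, not_nonempty_iff] at hne
      have := h (fun _ => 1) (Subsingleton.elim _ _)
      simpa using congrFun this none
    obtain ⟨_, v₀, rfl⟩ := hne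
    have hne : (affineSpan ℝ (Set.range p) : Set (EuclideanSpace ℝ (Fin d))).Nonempty :=
      ⟨p v₀, mem_affineSpan ℝ ⟨v₀, rfl⟩⟩
    rw [← AffineSubspace.direction_eq_top_iff_of_nonempty hne]
    by_contra hdir
    obtain ⟨f, hf, hle⟩ := Submodule.exists_le_ker_of_lt_top _ (lt_top_iff_ne_top.2 hdir)
    have hexp (x : EuclideanSpace ℝ (Fin d)) :
        f x = ∑ i, f (EuclideanSpace.single i 1) * x i := by
      conv_lhs => rw [← (EuclideanSpace.basisFun (Fin d) ℝ).sum_repr x]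
      simp [mul_comm]
    have := h (fun o => o.elim (-f (p v₀)) fun i => f (EuclideanSpace.single i 1)) <| by
      funext v
      rw [hmul]
      simp only [Option.elim, ← hexp]
      have : f (p v - p v₀) = 0 := hle <| AffineSubspace.vsub_mem_direction
        (mem_affineSpan ℝ ⟨v, rfl⟩) (mem_affineSpan ℝ ⟨v₀, rfl⟩)
      rw [map_sub] at this
      simpa [← sub_eq_add_neg] using this
    apply hf
    ext x
    rw [hexp]
    refine Finset.sum_eq_zero fun i _ => ?_
    have := congrFun this (some i)
    simp only [Option.elim] at this
    simp [this]
  · intro hp c hc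
    obtain ⟨ha, hb⟩ := eq_zero_of_sum_add_eq_zero_of_affineSpan_eq_top hp
      (a := fun i => c (some i)) (b := c none) fun v => by rw [← hmul, hc]; rfl
    funext o
    cases o with
    | none => exact hb
    | some i => exact congrFun ha i

open MvPolynomial in
theorem IsGenericConfig.affineSpan_eq_top {V : Type*} [Fintype V] {d : ℕ}
    {p q : V → EuclideanSpace ℝ (Fin d)} (hq : IsGenericConfig d q)
    (hp : affineSpan ℝ (Set.range p) = ⊤) : affineSpan ℝ (Set.range q) = ⊤ := by
  rw [← rank_homogeneousMatrix_eq_iff] at hp ⊢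
  let M : Matrix V (Option (Fin d)) (MvPolynomial (V × Fin d) ℚ) :=
    fun v o => o.elim 1 fun i => X (v, i)
  have hM (p : V → EuclideanSpace ℝ (Fin d)) :
      M.map (aeval fun vi : V × Fin d => p vi.1 vi.2) = homogeneousMatrix p := by
    ext v o
    rw [Matrix.map_apply]
    cases o <;> simp [M, homogeneousMatrix]
  have hle := M.rank_map_aeval_le_of_algebraicIndependent hq fun vi => p vi.1 vi.2
  rw [hM, hM, hp] at hle
  refine le_antisymm ?_ hle
  simpa using (homogeneousMatrix q).rank_le_card_width

open MvPolynomial in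
theorem IsGenericConfig.rank_rigidityMatrix_le {V : Type*} [Fintype V] [DecidableEq V] {d : ℕ}
    (G : SimpleGraph V) [DecidableRel G.Adj]
    (p : V → EuclideanSpace ℝ (Fin d)) {q : V → EuclideanSpace ℝ (Fin d)}
    (hq : IsGenericConfig d q) : (rigidityMatrix G p).rank ≤ (rigidityMatrix G q).rank := by
  let M : Matrix G.edgeSet (V × Fin d) (MvPolynomial (V × Fin d) ℚ) := fun e vi =>
    if h : vi.1 ∈ (e : Sym2 V) then X vi - X (Sym2.Mem.other h, vi.2) else 0
  have hM (p : V → EuclideanSpace ℝ (Fin d)) :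
      M.map (aeval fun vi : V × Fin d => p vi.1 vi.2) = rigidityMatrix G p := by
    ext e vi
    rw [Matrix.map_apply]
    simp only [M, rigidityMatrix]
    split_ifs <;> simp
  simpa only [hM] using M.rank_map_aeval_le_of_algebraicIndependent hq fun vi => p vi.1 vi.2

theorem rigidityMatrix_mulVec_apply {V : Type*} [Fintype V] [DecidableEq V] {d : ℕ}
    (G : SimpleGraph V) (p : V → EuclideanSpace ℝ (Fin d)) (m : V × Fin d → ℝ) {u v : V}
    (h : G.Adj u v) :
    (rigidityMatrix G p).mulVec m ⟨s(u, v), h⟩ =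
      ∑ i, (p u i - p v i) * (m (u, i) - m (v, i)) := by
  have hu (i : Fin d) : rigidityMatrix G p ⟨s(u, v), h⟩ (u, i) = p u i - p v i := by
    have hm : u ∈ s(u, v) := Sym2.mem_mk_left u v
    have ho : Sym2.Mem.other hm = v := Sym2.congr_right.1 (Sym2.other_spec hm)
    simp only [rigidityMatrix, dif_pos hm, ho]
    rfl
  have hv (i : Fin d) : rigidityMatrix G p ⟨s(u, v), h⟩ (v, i) = p v i - p u i := by
    have hm : v ∈ s(u, v) := Sym2.mem_mk_right u v
    have ho : Sym2.Mem.other hm = u :=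
      Sym2.congr_right.1 ((Sym2.other_spec hm).trans Sym2.eq_swap)
    simp only [rigidityMatrix, dif_pos hm, ho]
    rfl
  have h0 (w : V) (hw : w ≠ u ∧ w ≠ v) (i : Fin d) :
      rigidityMatrix G p ⟨s(u, v), h⟩ (w, i) = 0 := by
    simp [rigidityMatrix, hw]
  rw [Matrix.mulVec, dotProduct, Fintype.sum_prod_type,
    Fintype.sum_eq_add u v h.ne fun w hw => Finset.sum_eq_zero fun i _ => by simp [h0 w hw],
    ← Finset.sum_add_distrib]
  refine Finset.sum_congr rfl fun i _ => ?_
  rw [hu, hv]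
  ring

/-- The skew-symmetric matrix whose entry at `(i, j)` with `i < j` is `f s(i, j)`. -/
def skewOfSym2 {d : ℕ} (f : Sym2 (Fin d) → ℝ) (i j : Fin d) : ℝ :=
  (SignType.sign ((j : ℤ) - i) : ℝ) * f s(i, j)

theorem skewOfSym2_swap {d : ℕ} (f : Sym2 (Fin d) → ℝ) (i j : Fin d) :
    skewOfSym2 f j i = -skewOfSym2 f i j := by
  rw [skewOfSym2, skewOfSym2, ← neg_sub, Left.sign_neg, Sym2.eq_swap]
  simp

/-- The infinitesimal isometries of `ℝ^d` restricted to `p`: the off-diagonal values of `f`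
give a skew-symmetric matrix, and the diagonal values give a translation. -/
def trivialMotion {V : Type*} {d : ℕ} (p : V → EuclideanSpace ℝ (Fin d)) :
    (Sym2 (Fin d) → ℝ) →ₗ[ℝ] (V × Fin d → ℝ) where
  toFun f vi := ∑ j, skewOfSym2 f vi.2 j * p vi.1 j + f s(vi.2, vi.2)
  map_add' f g := by
    funext vi
    simp only [skewOfSym2, Pi.add_apply, mul_add, add_mul, Finset.sum_add_distrib]
    ring
  map_smul' c f := by
    funext vi
    simp only [skewOfSym2, Pi.smul_apply, smul_eq_mul, RingHom.id_apply, mul_add, Finset.mul_sum]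
    congr 1
    exact Finset.sum_congr rfl fun j _ => by ring

theorem trivialMotion_injective {V : Type*} {d : ℕ} {p : V → EuclideanSpace ℝ (Fin d)}
    (hp : affineSpan ℝ (Set.range p) = ⊤) : Function.Injective (trivialMotion p) := by
  rw [injective_iff_map_eq_zero]
  intro f hf
  have key (i : Fin d) := eq_zero_of_sum_add_eq_zero_of_affineSpan_eq_top hp
    (a := skewOfSym2 f i) (b := f s(i, i)) fun v => congrFun hf (v, i)
  funext e
  induction e using Sym2.ind with
  | _ i j =>
    by_cases hij : i = j
    · subst hij
      exact (key i).2
    · have h := congrFun (key i).1 j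
      have hs : (j : ℤ) - i ≠ 0 := by omega
      rcases mul_eq_zero.1 h with h | h
      · rcases lt_or_gt_of_ne hs with hs | hs 
        · simp [sign_neg hs] at h
        · simp [sign_pos hs] at h
      · exact h

theorem rigidityMatrix_mulVec_trivialMotion {V : Type*} [Fintype V] [DecidableEq V] {d : ℕ}
    (G : SimpleGraph V) (p : V → EuclideanSpace ℝ (Fin d)) (f : Sym2 (Fin d) → ℝ) :
    (rigidityMatrix G p).mulVec (trivialMotion p f) = 0 := by
  funext ⟨e, he⟩
  induction e using Sym2.ind with
  | _ u v =>
    rw [rigidityMatrix_mulVec_apply G p _ he]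
    have h : ∑ i, (p u i - p v i) * (trivialMotion p f (u, i) - trivialMotion p f (v, i)) =
        ∑ i, ∑ j, skewOfSym2 f i j * ((p u i - p v i) * (p u j - p v j)) := by
      refine Finset.sum_congr rfl fun i _ => ?_
      simp only [trivialMotion, LinearMap.coe_mk, AddHom.coe_mk, add_sub_add_right_eq_sub,
        ← Finset.sum_sub_distrib, Finset.mul_sum]
      exact Finset.sum_congr rfl fun j _ => by ring
    have hneg : ∑ i, ∑ j, skewOfSym2 f i j * ((p u i - p v i) * (p u j - p v j)) =
        -∑ i, ∑ j, skewOfSym2 f i j * ((p u i - p v i) * (p u j - p v j)) := by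
      conv_lhs => rw [Finset.sum_comm]
      simp only [← Finset.sum_neg_distrib]
      refine Finset.sum_congr rfl fun i _ => Finset.sum_congr rfl fun j _ => ?_
      rw [skewOfSym2_swap f i j]
      ring
    rw [h, Pi.zero_apply]
    linarith

theorem rank_rigidityMatrix_le_of_affineSpan_eq_top {V : Type*} [Fintype V] [DecidableEq V]
    {d : ℕ} (G : SimpleGraph V) {p : V → EuclideanSpace ℝ (Fin d)}
    (hp : affineSpan ℝ (Set.range p) = ⊤) :
    (rigidityMatrix G p).rank ≤ d * Fintype.card V - d * (d + 1) / 2 := by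
  have hker : LinearMap.range (trivialMotion p) ≤
      LinearMap.ker (rigidityMatrix G p).mulVecLin := by
    rintro _ ⟨f, rfl⟩
    exact rigidityMatrix_mulVec_trivialMotion G p f
  have hdim := Submodule.finrank_mono hker
  rw [LinearMap.finrank_range_of_inj (trivialMotion_injective hp), Module.finrank_fintype_fun_eq_card,
    Sym2.card, Fintype.card_fin, Nat.choose_two_right, Nat.add_sub_cancel, mul_comm (d + 1)] at hdim
  have hrn := (rigidityMatrix G p).mulVecLin.finrank_range_add_finrank_ker
  rw [Module.finrank_fintype_fun_eq_card, Fintype.card_prod, Fintype.card_fin, mul_comm] at hrn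
  rw [Matrix.rank]
  omega

/-- Infinitesimal rigidity is a generic property: if some configuration of `G` in ℝ^d
is infinitesimally rigid, then every generic configuration of `G` in ℝ^d is
infinitesimally rigid. -/
theorem infinitesimal_rigidity_is_generic
    {V : Type*} [Fintype V] [DecidableEq V] {d : ℕ} (hd : 1 ≤ d)
    (G : SimpleGraph V) [DecidableRel G.Adj]
    (h : ∃ p₀ : V → EuclideanSpace ℝ (Fin d), InfinitesimallyRigid G p₀) :
    ∀ q : V → EuclideanSpace ℝ (Fin d), IsGenericConfig d q →
      InfinitesimallyRigid G q := by
  obtain ⟨p₀, hspan, hrank⟩ := h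
  intro q hq
  have hqspan := hq.affineSpan_eq_top hspan
  exact ⟨hqspan, (rank_rigidityMatrix_le_of_affineSpan_eq_top G hqspan).antisymm
    (hrank ▸ hq.rank_rigidityMatrix_le G p₀)⟩
end
end

section
/- Let G = (V, E) be a finite simple graph, P ⊆ V a pinned set with |P| ≥ 3, and p : V → ℝ² a generic configuration such that the pinned framework (G, p, P) is isostatic. Fix an edge e ∈ E and let M ⊆ (ℝ²)^V be the set of configurations q : V → ℝ² with q(v) = p(v) for all v ∈ P and ‖q(u) − q(v)‖ = ‖p(u) − p(v)‖ for every edge {u, v} ∈ E \ {e}, equipped with the subspace topology. Then M is a nonempty compact topological 1-manifold, and each connected component of M is homeomorphic to the circle S¹. -/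
noncomputable section

/-- The Euclidean plane ℝ². -/
abbrev Plane := EuclideanSpace ℝ (Fin 2)

/-- The pinned rigidity matrix of the framework `(G, p)` with pinned set `P`:
one row per edge, two columns per free vertex; the row of an edge `{u, v}` contains
`p u - p v` in the columns of `u` when `u` is free, `p v - p u` in the columns of `v`
when `v` is free, and zeros elsewhere. -/
def pinnedRigidityMatrix {V : Type*} [DecidableEq V] (G : SimpleGraph V) (P : Set V)
    [DecidablePred (· ∈ P)] (p : V → Plane) :
    Matrix G.edgeSet ({v : V // v ∉ P} × Fin 2) ℝ :=
  fun e vi =>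
    if h : (vi.1 : V) ∈ (e : Sym2 V) then (p vi.1 - p (Sym2.Mem.other h)) vi.2 else 0

/-- The pinned framework `(G, p, P)` is isostatic: `|E| = 2|F|` where `F = V \ P`
is the set of free vertices, and the (square) pinned rigidity matrix is nonsingular,
i.e. has full rank. -/
def PinnedIsostatic {V : Type*} [Fintype V] [DecidableEq V] (G : SimpleGraph V)
    [DecidableRel G.Adj] (P : Set V) [DecidablePred (· ∈ P)] (p : V → Plane) : Prop :=
  Fintype.card G.edgeSet = 2 * Fintype.card {v : V // v ∉ P} ∧
  (pinnedRigidityMatrix G P p).rank = 2 * Fintype.card {v : V // v ∉ P}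

/-- The configuration space `M` obtained by removing the edge `e`: configurations `q`
agreeing with `p` on the pinned set `P` and having the same length as `p` on every
edge of `G` other than `e`.  It carries the subspace topology from `(ℝ²)^V`. -/
def flexSpace {V : Type*} (G : SimpleGraph V) (P : Set V) (p : V → Plane)
    (e : Sym2 V) : Set (V → Plane) :=
  {q | (∀ v ∈ P, q v = p v) ∧
    ∀ ⦃u w : V⦄, G.Adj u w → s(u, w) ≠ e → dist (q u) (q w) = dist (p u) (p w)}

open MvPolynomial in
/-- Derivations of `ℝ` over `ℚ` take arbitrary values on an algebraically independent family. -/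
theorem AlgebraicIndependent.exists_derivation_eq {ι : Type*} {x : ι → ℝ}
    (hx : AlgebraicIndependent ℚ x) (c : ι → ℝ) :
    ∃ D : Derivation ℚ ℝ ℝ, ∀ i, D (x i) = c i := by
  obtain ⟨B, hsB, hB⟩ := exists_isTranscendenceBasis_superset
    (R := ℚ) (s := Set.range x) hx.to_subtype_range
  let _ : Algebra (MvPolynomial B ℚ) ℝ := (aeval ((↑) : B → ℝ)).toAlgebra
  have hmap (f : MvPolynomial B ℚ) : algebraMap (MvPolynomial B ℚ) ℝ f = aeval (↑) f := rfl
  have : IsScalarTower ℚ (MvPolynomial B ℚ) ℝ := IsScalarTower.of_algebraMap_eq fun r => by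
    rw [hmap, MvPolynomial.algebraMap_eq, aeval_C]
  have : FaithfulSMul (MvPolynomial B ℚ) ℝ :=
    (faithfulSMul_iff_algebraMap_injective _ _).2 hB.1
  have : Algebra.IsAlgebraic (MvPolynomial B ℚ) ℝ := by
    have := hB.isAlgebraic
    refine ⟨fun r => ?_⟩
    exact (Algebra.IsAlgebraic.isAlgebraic (R := Algebra.adjoin ℚ (Set.range ((↑) : B → ℝ)))
      r).of_ringHom_of_comp_eq hB.1.aevalEquiv (RingHom.id ℝ) hB.1.aevalEquiv.surjective
      Function.injective_id rfl
  let K := FractionRing (MvPolynomial B ℚ)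
  let _ : Algebra K ℝ := FractionRing.liftAlgebra _ _
  have : Algebra.IsAlgebraic K ℝ := Algebra.IsAlgebraic.extendScalars
    (IsFractionRing.injective (MvPolynomial B ℚ) K)
  have : Algebra.FormallyEtale (MvPolynomial B ℚ) K :=
    Algebra.FormallyEtale.of_isLocalization (nonZeroDivisors (MvPolynomial B ℚ))
  have : Algebra.FormallyEtale K ℝ := Algebra.FormallyEtale.of_isSeparable K ℝ
  have : Algebra.FormallyEtale (MvPolynomial B ℚ) ℝ := Algebra.FormallyEtale.comp _ K _
  classical
  let d : B → ℝ := fun b => if h : ∃ i, x i = b then c h.choose else 0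
  let D₀ : Derivation ℚ (MvPolynomial B ℚ) ℝ := mkDerivation ℚ d
  have hbc := KaehlerDifferential.isBaseChange_of_formallyEtale ℚ (MvPolynomial B ℚ) ℝ
  refine ⟨(hbc.lift D₀.liftKaehlerDifferential).compDer (KaehlerDifferential.D ℚ ℝ), fun i => ?_⟩
  let b : B := ⟨x i, hsB ⟨i, rfl⟩⟩
  have h1 : x i = algebraMap (MvPolynomial B ℚ) ℝ (X b) := by simp [hmap, b]
  have h2 := hbc.lift_eq D₀.liftKaehlerDifferential (KaehlerDifferential.D ℚ _ (X b))
  rw [KaehlerDifferential.map_D] at h2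
  have h3 : ∃ j, x j = b := ⟨i, rfl⟩
  have h4 : h3.choose = i := hx.injective h3.choose_spec
  rw [h1]
  refine h2.trans ?_
  simp only [Derivation.liftKaehlerDifferential_comp_D, D₀, mkDerivation_X, d, dif_pos h3, h4]

open MvPolynomial in
theorem MvPolynomial.eq_C_of_pderiv_eq_zero {σ : Type*} {P : MvPolynomial σ ℚ}
    (h : ∀ i, pderiv i P = 0) : P = C (coeff 0 P) := by
  classical
  ext m
  rw [coeff_C]
  split_ifs with hm
  · rw [hm]
  · obtain ⟨i, hi⟩ : ∃ i, m i ≠ 0 := by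
      by_contra! h'
      exact hm (Finsupp.ext fun i => (h' i).symm)
    have := coeff_pderiv (i := i) P (m - Finsupp.single i 1)
    rw [h i, coeff_zero, tsub_add_cancel_of_le (by simpa [Nat.one_le_iff_ne_zero] using hi)] at this
    exact (mul_eq_zero.1 this.symm).resolve_right (by positivity)

open MvPolynomial in
theorem MvPolynomial.totalDegree_pderiv_lt {σ : Type*} {P : MvPolynomial σ ℚ} {i : σ}
    (h : pderiv i P ≠ 0) : (pderiv i P).totalDegree < P.totalDegree := by
  classical
  obtain ⟨m, hm, hd⟩ := (pderiv i P).support.exists_mem_eq_sup (support_nonempty.2 h)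
    (fun s => s.sum fun _ e => e)
  rw [mem_support_iff, coeff_pderiv] at hm
  have := le_totalDegree (mem_support_iff.2 (left_ne_zero_of_mul hm))
  rw [Finsupp.sum_add_index' (by simp) (by simp)] at this
  rw [totalDegree, hd]
  simp at this
  omega

open MvPolynomial in
theorem Derivation.map_mvPolynomial_aeval {ι : Type*} [Fintype ι] (D : Derivation ℚ ℝ ℝ)
    (g : ι → ℝ) (P : MvPolynomial ι ℚ) :
    D (aeval g P) = ∑ i, aeval g (pderiv i P) * D (g i) := by
  classical
  induction P using MvPolynomial.induction_on with
  | C a => simpa using D.map_algebraMap a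
  | add P Q hP hQ => simp [hP, hQ, add_mul, Finset.sum_add_distrib]
  | mul_X P j hP =>
    simp only [map_mul, aeval_X, Derivation.leibniz, hP, smul_eq_mul, pderiv_X, map_add,
      add_mul, Finset.sum_add_distrib, Finset.mul_sum]
    congr 1
    · simp [Pi.single_apply, apply_ite]
    · exact Finset.sum_congr rfl fun i _ => by ring

open MvPolynomial in
/-- A family of reals is algebraically independent over `ℚ` as soon as its images under derivations
satisfy no common linear relation. -/
theorem algebraicIndependent_of_derivation {ι : Type*} [Fintype ι] {g : ι → ℝ}
    (hg : ∀ a : ι → ℝ, (∀ D : Derivation ℚ ℝ ℝ, ∑ i, a i * D (g i) = 0) → a = 0) :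
    AlgebraicIndependent ℚ g := by
  rw [algebraicIndependent_iff]
  intro P
  induction hn : P.totalDegree using Nat.strong_induction_on generalizing P with
  | _ n ih =>
    subst hn
    intro hP
    have key : (fun i => aeval g (pderiv i P)) = 0 := by
      refine hg _ fun D => ?_
      rw [← D.map_mvPolynomial_aeval, hP, map_zero]
    have hz : ∀ i, pderiv i P = 0 := fun i => by
      by_contra hne
      exact hne (ih _ (totalDegree_pderiv_lt hne) _ rfl (congrFun key i))
    rw [eq_C_of_pderiv_eq_zero hz] at hP ⊢
    simpa using hP

section

open Set Filter Topology NNReal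

/-- A bounded Lipschitz vector field has global integral curves. -/
theorem LipschitzWith.exists_hasDerivAt_integralCurve {E : Type*} [NormedAddCommGroup E]
    [NormedSpace ℝ E] [CompleteSpace E] {X : E → E} {K L : ℝ≥0} (hX : LipschitzWith K X)
    (hb : ∀ x, ‖X x‖ ≤ L) (x : E) :
    ∃ γ : ℝ → E, γ 0 = x ∧ ∀ t, HasDerivAt γ (X (γ t)) t := by
  have hloc (a : ℝ) (ha : 0 < a) :
      ∃ γ : ℝ → E, γ 0 = x ∧ ∀ t ∈ Ioo (-a) a, HasDerivAt γ (X (γ t)) t := by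
    let t₀ : Icc (-a) a := ⟨0, by simp [ha.le]⟩
    have hP : IsPicardLindelof (fun _ ↦ X) t₀ x (L * ⟨a, ha.le⟩) 0 L K := by
      refine IsPicardLindelof.of_time_independent (fun y _ => hb y) hX.lipschitzOnWith ?_
      simp only [t₀, sub_zero, zero_sub, neg_neg, max_self, NNReal.coe_zero]
      exact le_rfl
    obtain ⟨γ, h0, h⟩ := hP.exists_eq_forall_mem_Icc_hasDerivWithinAt₀
    exact ⟨γ, h0, fun t ht => (h t (Ioo_subset_Icc_self ht)).hasDerivAt (Icc_mem_nhds ht.1 ht.2)⟩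
  choose! γ h0 hγ using hloc
  have heq {a b : ℝ} (ha : 0 < a) (hab : a ≤ b) : EqOn (γ a) (γ b) (Ioo (-a) a) :=
    ODE_solution_unique_of_mem_Ioo (v := fun _ => X) (s := fun _ => univ) (t₀ := 0)
      (fun t _ => hX.lipschitzOnWith)
      ⟨by linarith, ha⟩ (fun t ht => ⟨hγ a ha t ht, mem_univ _⟩)
      (fun t ht => ⟨hγ b (ha.trans_le hab) t ⟨by linarith [ht.1], by linarith [ht.2]⟩, mem_univ _⟩)
      ((h0 a ha).trans (h0 b (ha.trans_le hab)).symm)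
  refine ⟨fun t => γ (|t| + 1) t, h0 _ (by positivity), fun t => ?_⟩
  have ht : t ∈ Ioo (-(|t| + 1)) (|t| + 1) := abs_lt.1 (lt_add_one _)
  have hval : γ (|t| + 1) t = γ (|t| + 2) t := heq (by positivity) (by linarith) ht
  refine (hγ (|t| + 2) (by positivity) t (abs_lt.1 (by linarith))).congr_of_eventuallyEq ?_
    |>.congr_deriv (congrArg X hval.symm)
  · filter_upwards [Metric.ball_mem_nhds t one_pos] with s hs
    rw [Metric.mem_ball, Real.dist_eq] at hs
    have := abs_sub_abs_le_abs_sub s t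
    exact heq (by positivity) (by linarith) (abs_lt.1 (lt_add_one _))

/-- If a compact Hausdorff space carries a flow whose orbit maps are locally surjective and
nonconstant, then its components are open circles. -/
theorem connectedComponent_homeomorph_circle_of_flow {M : Type*} [TopologicalSpace M] [T2Space M]
    [CompactSpace M] (Φ : M → ℝ → M) (hc : ∀ x, Continuous (Φ x)) (h0 : ∀ x, Φ x 0 = x)
    (hadd : ∀ x s t, Φ x (s + t) = Φ (Φ x s) t) (hn : ∀ x, 𝓝 x ≤ map (Φ x) (𝓝 0))
    (hne : ∀ x, ∃ t, Φ x t ≠ x) (x : M) :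
    IsOpen (connectedComponent x) ∧ Nonempty (connectedComponent x ≃ₜ Circle) := by
  have hopen (x : M) : IsOpenMap (Φ x) := by
    rw [isOpenMap_iff_nhds_le]
    intro s
    have h1 : Φ (Φ x s) = Φ x ∘ (s + ·) := funext fun t => (hadd x s t).symm
    refine (hn _).trans_eq ?_
    rw [h1, ← Filter.map_map, map_add_left_nhds_zero]
  have hself (y : M) : y ∈ range (Φ y) := ⟨0, h0 y⟩
  have hneg (y : M) (s : ℝ) : Φ (Φ y s) (-s) = y := by rw [← hadd, add_neg_cancel, h0]
  have hcompl : (range (Φ x))ᶜ = ⋃ y ∈ (range (Φ x))ᶜ, range (Φ y) := by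
    ext z
    simp only [mem_iUnion]
    refine ⟨fun hz => ⟨z, hz, hself z⟩, ?_⟩
    rintro ⟨y, hy, s, rfl⟩ ⟨t, ht⟩
    exact hy ⟨t + -s, by rw [hadd, ht, hneg]⟩
  have hclopen : IsClopen (range (Φ x)) := by
    refine ⟨⟨?_⟩, (hopen x).isOpen_range⟩
    rw [hcompl]
    exact isOpen_biUnion fun y _ => (hopen y).isOpen_range
  have hcomp : connectedComponent x = range (Φ x) :=
    (hclopen.connectedComponent_subset (hself x)).antisymm
      ((isPreconnected_range (hc x)).subset_connectedComponent (hself x))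
  rw [hcomp]
  refine ⟨hclopen.2, ?_⟩
  let H : AddSubgroup ℝ :=
    { carrier := {t | Φ x t = x}
      zero_mem' := h0 x
      add_mem' := fun {s t} hs ht => by
        change Φ x (s + t) = x
        rw [hadd, show Φ x s = x from hs, show Φ x t = x from ht]
      neg_mem' := fun {t} ht => by
        have := hneg x t
        rwa [show Φ x t = x from ht] at this }
  have hH (t : ℝ) : t ∈ H ↔ Φ x t = x := Iff.rfl
  have hHc : IsClosed (H : Set ℝ) := isClosed_eq (hc x) continuous_const
  have heq {s t : ℝ} (h : Φ x s = Φ x t) : -t + s ∈ H := by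
    rw [hH, add_comm, hadd, h, hneg]
  rcases H.dense_or_cyclic with hd | ⟨T, hT⟩
  · obtain ⟨t, ht⟩ := hne x
    have := hd.closure_eq
    rw [hHc.closure_eq] at this
    exact absurd ((hH t).1 (show t ∈ (H : Set ℝ) from this ▸ mem_univ t)) ht
  · rw [← AddSubgroup.zmultiples_eq_closure] at hT
    have hper : Function.Periodic (Φ x) T := fun s => by
      have : T ∈ H := hT ▸ AddSubgroup.mem_zmultiples T
      rw [add_comm, hadd, (hH T).1 this]
    have hemb : IsOpenEmbedding (hper.lift : AddCircle T → M) := by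
      refine .of_continuous_injective_isOpenMap ?_ ?_ ?_
      · exact continuous_quot_lift _ (hc x)
      · intro a b
        induction a using QuotientAddGroup.induction_on with | _ s
        induction b using QuotientAddGroup.induction_on with | _ t
        intro h
        rw [hper.lift_coe, hper.lift_coe] at h
        rw [QuotientAddGroup.eq, ← hT]
        exact heq h.symm
      · intro U hU
        rw [← image_preimage_eq U (QuotientAddGroup.mk_surjective
          (s := AddSubgroup.zmultiples T)), ← image_comp]
        exact hopen x _ (hU.preimage continuous_quotient_mk')
    have hrange : range (hper.lift : AddCircle T → M) = range (Φ x) := by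
      rw [← (QuotientAddGroup.mk_surjective (s := AddSubgroup.zmultiples T)).range_comp]
      rfl
    have e := hemb.isEmbedding.toHomeomorph.trans (Homeomorph.setCongr hrange)
    have hT0 : T ≠ 0 := by
      rintro rfl
      have hinj : Function.Injective (Φ x) := fun s t hst => by
        have := heq hst
        rw [hT, AddSubgroup.zmultiples_zero_eq_bot, AddSubgroup.mem_bot] at this
        linarith
      have hind := (IsOpenEmbedding.of_continuous_injective_isOpenMap (hc x) hinj
        (hopen x)).isEmbedding.isInducing
      refine noncompact_univ ℝ (hind.isCompact_iff.2 ?_)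
      rw [image_univ]
      exact hclopen.1.isCompact
    exact ⟨e.symm.trans (AddCircle.homeomorphCircle hT0)⟩

/-- A compact level set carrying a nonvanishing tangent field that spans the kernel of the
differential is a disjoint union of open circles. -/
theorem connectedComponent_homeomorph_circle_of_levelSet {E G : Type*} [NormedAddCommGroup E]
    [NormedSpace ℝ E] [FiniteDimensional ℝ E] [NormedAddCommGroup G] [NormedSpace ℝ G]
    [FiniteDimensional ℝ G] {g : E → G} {c : G} {X : E → E} (hg : ContDiff ℝ 1 g)
    (hX : ContDiff ℝ 1 X) (hcpt : IsCompact (g ⁻¹' {c}))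
    (htan : ∀ x, fderiv ℝ g x (X x) = 0)
    (hker : ∀ x ∈ g ⁻¹' {c}, ∀ z, fderiv ℝ g x z = 0 → ∃ t : ℝ, z = t • X x)
    (hX0 : ∀ x ∈ g ⁻¹' {c}, X x ≠ 0) (x : g ⁻¹' {c}) :
    IsOpen (connectedComponent x) ∧ Nonempty (connectedComponent x ≃ₜ Circle) := by
  obtain ⟨R, hR0, hR⟩ := hcpt.isBounded.subset_closedBall_lt 0 0
  let f : ContDiffBump (0 : E) := ⟨R, R + 1, hR0, by linarith⟩
  let Y : E → E := fun y => f y • X y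
  have hYX : ∀ y ∈ g ⁻¹' {c}, Y y = X y := fun y hy => by
    simp [Y, f.one_of_mem_closedBall (hR hy)]
  have hY : ContDiff ℝ 1 Y := f.contDiff.smul hX
  have hYs : HasCompactSupport Y := f.hasCompactSupport.smul_right
  obtain ⟨K, hK⟩ := hY.lipschitzWith_of_hasCompactSupport hYs one_ne_zero
  obtain ⟨L, hL⟩ := hYs.exists_bound_of_continuous hY.continuous
  have hL' : ∀ y, ‖Y y‖ ≤ L.toNNReal := fun y => (hL y).trans (Real.le_coe_toNNReal L)
  choose γ hγ0 hγ using hK.exists_hasDerivAt_integralCurve hL'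
  have hγc (y : E) : Continuous (γ y) :=
    continuous_iff_continuousAt.2 fun t => (hγ y t).continuousAt
  have hγadd (y : E) (s t : ℝ) : γ y (s + t) = γ (γ y s) t := by
    refine congrFun (ODE_solution_unique_univ (v := fun _ => Y) (s := fun _ => univ) (t₀ := 0)
      (f := fun t => γ y (s + t)) (g := γ (γ y s)) (fun t => hK.lipschitzOnWith)
      (fun t => ⟨?_, mem_univ _⟩) (fun t => ⟨hγ _ t, mem_univ _⟩) (by simp [hγ0])) t
    exact (hγ y (s + t)).comp_const_add s t
  have hγM (y : E) (hy : y ∈ g ⁻¹' {c}) (t : ℝ) : γ y t ∈ g ⁻¹' {c} := by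
    have hd (t : ℝ) : HasDerivAt (g ∘ γ y) 0 t := by
      have := ((hg.differentiable one_ne_zero (γ y t)).hasFDerivAt).comp_hasDerivAt t (hγ y t)
      simpa [Y, htan] using this
    have := is_const_of_deriv_eq_zero (fun t => (hd t).differentiableAt) (fun t => (hd t).deriv) t 0
    simp only [Function.comp_apply, hγ0] at this
    rw [mem_preimage, this]
    exact hy
  have : CompactSpace (g ⁻¹' {c}) := isCompact_iff_compactSpace.1 hcpt
  refine connectedComponent_homeomorph_circle_of_flow
    (M := g ⁻¹' {c}) (fun y t => ⟨γ y t, hγM y y.2 t⟩) (fun y => (hγc y).subtype_mk _)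
    (fun y => Subtype.ext (hγ0 y)) (fun y s t => Subtype.ext (hγadd y s t)) ?_ ?_ x
  · rintro ⟨y, hy⟩
    obtain ⟨ℓ, hℓ⟩ := SeparatingDual.exists_ne_zero (R := ℝ) (hX0 y hy)
    have hh : HasStrictFDerivAt (fun z => (g z, ℓ z)) ((fderiv ℝ g y).prod ℓ) y :=
      (hg.contDiffAt.hasStrictFDerivAt one_ne_zero).prodMk ℓ.hasStrictFDerivAt
    have hinj : LinearMap.ker ((fderiv ℝ g y).prod ℓ : E →ₗ[ℝ] G × ℝ) = ⊥ := by
      refine LinearMap.ker_eq_bot'.2 fun z hz => ?_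
      obtain ⟨hz1, hz2⟩ : fderiv ℝ g y z = 0 ∧ ℓ z = 0 := by simpa using hz
      obtain ⟨t, rfl⟩ := hker y hy z hz1
      have : t = 0 := by simpa [hℓ] using hz2
      simp [this]
    obtain ⟨l, hl⟩ := LinearMap.exists_leftInverse_of_injective _ hinj
    have hid : HasStrictFDerivAt (fun z => l.toContinuousLinearMap (g z, ℓ z))
        (ContinuousLinearEquiv.refl ℝ E : E →L[ℝ] E) y := by
      refine (l.toContinuousLinearMap.hasStrictFDerivAt.comp y hh).congr_fderiv ?_
      ext z
      exact LinearMap.congr_fun hl z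
    let W := (hid.toOpenPartialHomeomorph _).source
    have hWy : W ∈ 𝓝 y := (hid.toOpenPartialHomeomorph _).open_source.mem_nhds
      hid.mem_toOpenPartialHomeomorph_source
    have hWinj {a b : E} (ha : a ∈ W) (hb : b ∈ W) (hab : (g a, ℓ a) = (g b, ℓ b)) : a = b :=
      (hid.toOpenPartialHomeomorph _).injOn ha hb (congrArg l.toContinuousLinearMap hab)
    have hs : HasStrictDerivAt (fun t => ℓ (γ y t)) (ℓ (X y)) 0 := by
      have := hasStrictDerivAt_of_hasDerivAt_of_continuousAt
        (Eventually.of_forall (f := 𝓝 (0 : ℝ)) (hγ y))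
        (hY.continuous.comp (hγc y)).continuousAt
      rw [hγ0, hYX y hy] at this
      exact ℓ.hasStrictFDerivAt.comp_hasStrictDerivAt 0 this
    have hmap := hs.map_nhds_eq hℓ
    rw [hγ0] at hmap
    refine fun U hU => ?_
    have hU' : _ ∩ γ y ⁻¹' W ∈ 𝓝 (0 : ℝ) :=
      inter_mem hU ((hγc y).continuousAt.preimage_mem_nhds (by rwa [hγ0]))
    have him := hmap ▸ image_mem_map hU'
    rw [mem_nhds_subtype]
    refine ⟨W ∩ ℓ ⁻¹' _, inter_mem hWy (ℓ.continuous.continuousAt.preimage_mem_nhds him), ?_⟩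
    rintro ⟨z, hz⟩ ⟨hzW, t, ⟨htU, htW⟩, hzt⟩
    have : z = γ y t := hWinj hzW htW (Prod.ext (hz.trans (hγM y hy t).symm) hzt.symm)
    have h2 : (⟨z, hz⟩ : g ⁻¹' {c}) = ⟨γ y t, hγM y hy t⟩ := Subtype.ext this
    rw [h2]
    exact htU
  · rintro ⟨y, hy⟩
    by_contra! hconst
    have h1 : γ y = fun _ => y := funext fun t => congrArg Subtype.val (hconst t)
    have h2 := hγ y 0
    rw [hγ0, hYX y hy, h1] at h2
    exact hX0 y hy (h2.unique (hasDerivAt_const _ _))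

end

open Matrix in
/-- If the rows of a square matrix other than row `i₀` are independent, the corresponding column
of the adjugate spans their common kernel. -/
theorem Matrix.adjugate_col_spans_ker {n : Type*} [Fintype n] [DecidableEq n] (A : Matrix n n ℝ)
    (i₀ : n) (hA : ∀ c : n → ℝ, ∃ z : n → ℝ, ∀ i ≠ i₀, (A *ᵥ z) i = c i) :
    (fun j => A.adjugate j i₀) ≠ 0 ∧
      ∀ z : n → ℝ, (∀ i ≠ i₀, (A *ᵥ z) i = 0) → ∃ t : ℝ, z = t • fun j => A.adjugate j i₀ := by
  let B : (n → ℝ) →ₗ[ℝ] ({i // i ≠ i₀} → ℝ) :=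
    LinearMap.pi fun i => (LinearMap.proj i.1).comp A.mulVecLin
  have hBapp (z : n → ℝ) (i) : B z i = (A *ᵥ z) i.1 := rfl
  have hker (z : n → ℝ) : z ∈ LinearMap.ker B ↔ ∀ i ≠ i₀, (A *ᵥ z) i = 0 := by
    simp [funext_iff, hBapp]
  have hsurj : LinearMap.range B = ⊤ := by
    refine LinearMap.range_eq_top.2 fun c => ?_
    obtain ⟨z, hz⟩ := hA fun i => if h : i ≠ i₀ then c ⟨i, h⟩ else 0
    exact ⟨z, funext fun i => by rw [hBapp, hz _ i.2, dif_pos i.2]⟩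
  have hfr : Module.finrank ℝ (LinearMap.ker B) = 1 := by
    have h1 := B.finrank_range_add_finrank_ker
    rw [hsurj, finrank_top, Module.finrank_fintype_fun_eq_card,
      Module.finrank_fintype_fun_eq_card, Fintype.card_subtype_compl, Fintype.card_subtype_eq] at h1
    have : 0 < Fintype.card n := Fintype.card_pos_iff.2 ⟨i₀⟩
    omega
  obtain ⟨⟨z₀, hz₀⟩, hne, hspan⟩ := finrank_eq_one_iff'.1 hfr
  have hz₀0 : z₀ ≠ 0 := fun h => hne (Subtype.ext h)
  have hmul (i : n) (hi : i ≠ i₀) : (A *ᵥ fun j => A.adjugate j i₀) i = 0 := by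
    have : (A * A.adjugate) i i₀ = 0 := by
      rw [mul_adjugate, smul_apply, one_apply_ne hi, smul_zero]
    exact this
  have hx0 : (fun j => A.adjugate j i₀) ≠ 0 := by
    intro h0
    let A' := A.updateRow i₀ z₀
    have hdet : A'.det ≠ 0 := by
      rw [← isUnit_iff_ne_zero, ← Matrix.isUnit_iff_isUnit_det, ← mulVec_injective_iff_isUnit]
      rw [← coe_mulVecLin, injective_iff_map_eq_zero]
      intro y hy
      have hy' (i : n) : (A' *ᵥ y) i = 0 := congrFun hy i
      have hyk : y ∈ LinearMap.ker B := (hker y).2 fun i hi => by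
        have hrow : A' i = A i := updateRow_ne hi
        have : A' i ⬝ᵥ y = 0 := hy' i
        rwa [hrow] at this
      obtain ⟨t, ht⟩ := hspan ⟨y, hyk⟩
      have ht : t • z₀ = y := congrArg Subtype.val ht
      have hrow : A' i₀ = z₀ := updateRow_self
      have : A' i₀ ⬝ᵥ y = 0 := hy' i₀
      rw [hrow, ← ht, dotProduct_smul, smul_eq_mul, mul_eq_zero,
        dotProduct_self_eq_zero] at this
      rw [← ht, this.resolve_right hz₀0, zero_smul]
    have hadj (j : n) : A'.adjugate j i₀ = 0 := by
      rw [adjugate_apply, updateRow_idem, ← adjugate_apply]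
      exact congrFun h0 j
    have h1 : (A' * A'.adjugate) i₀ i₀ = 0 := by simp [mul_apply, hadj]
    rw [mul_adjugate, smul_apply, one_apply_eq, smul_eq_mul, mul_one] at h1
    exact hdet h1
  refine ⟨hx0, fun z hz => ?_⟩
  obtain ⟨s, hs⟩ := hspan ⟨z, (hker z).2 hz⟩
  obtain ⟨r, hr⟩ := hspan ⟨_, (hker _).2 hmul⟩
  have hs : s • z₀ = z := congrArg Subtype.val hs
  have hr : r • z₀ = fun j => A.adjugate j i₀ := congrArg Subtype.val hr
  have hr0 : r ≠ 0 := by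
    rintro rfl
    exact hx0 (by rw [← hr, zero_smul])
  exact ⟨s * r⁻¹, by rw [← hr, smul_smul, inv_mul_cancel_right₀ hr0, hs]⟩

/-- A space that is locally homeomorphic to a charted space is itself charted. -/
theorem nonempty_chartedSpace_of_isOpen_homeomorph {H N M : Type*} [TopologicalSpace H]
    [TopologicalSpace N] [ChartedSpace H N] [TopologicalSpace M]
    (h : ∀ x : M, IsOpen (connectedComponent x) ∧ Nonempty (connectedComponent x ≃ₜ N)) :
    Nonempty (ChartedSpace H M) := by
  have hloc (x : M) : ∃ φ : OpenPartialHomeomorph M H, x ∈ φ.source := by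
    obtain ⟨ho, ⟨f⟩⟩ := h x
    let U : TopologicalSpace.Opens M := ⟨connectedComponent x, ho⟩
    have hxU : x ∈ U := mem_connectedComponent
    have hU : Nonempty U := ⟨⟨x, hxU⟩⟩
    let g : U ≃ₜ N := f
    let ψ := (U.openPartialHomeomorphSubtypeCoe hU).symm.trans
      (g.toOpenPartialHomeomorph.trans (chartAt H (g ⟨x, hxU⟩)))
    refine ⟨ψ, ?_⟩
    have h1 : (U.openPartialHomeomorphSubtypeCoe hU).symm x = ⟨x, hxU⟩ :=
      (U.openPartialHomeomorphSubtypeCoe hU).left_inv (x := ⟨x, hxU⟩) (by simp)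
    simp [ψ, h1, hxU]
  choose φ hφ using hloc
  exact ⟨{ atlas := Set.range φ
           chartAt := φ
           mem_chart_source := hφ
           chart_mem_atlas := fun x => ⟨x, rfl⟩ }⟩

open Matrix in
/-- The action of the pinned rigidity matrix on velocities that vanish on the pinned set. -/
theorem pinnedRigidityMatrix_mulVec {V : Type*} [Fintype V] [DecidableEq V] {G : SimpleGraph V}
    {P : Set V} [DecidablePred (· ∈ P)] (q z : V → Plane) (hz : ∀ v ∈ P, z v = 0) {e : G.edgeSet}
    {u w : V} (he : (e : Sym2 V) = s(u, w)) :
    (pinnedRigidityMatrix G P q *ᵥ fun vi => z vi.1 vi.2) e =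
      ∑ k, (q u k - q w k) * (z u k - z w k) := by
  obtain ⟨e, hG⟩ := e
  obtain rfl : e = s(u, w) := he
  have huw : u ≠ w := G.ne_of_adj hG
  let f : V → Fin 2 → ℝ := fun v k =>
    if v = u then (q u k - q w k) * z u k else if v = w then (q w k - q u k) * z w k else 0
  have hterm (v : {v : V // v ∉ P}) (k : Fin 2) :
      pinnedRigidityMatrix G P q ⟨s(u, w), hG⟩ (v, k) * z v k = f v k := by
    simp only [pinnedRigidityMatrix, f]
    split_ifs with h1 h2 h3 h4 h5
    · have : Sym2.Mem.other h1 = w := by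
        have := Sym2.other_spec h1
        generalize Sym2.Mem.other h1 = o at this
        rw [h2] at this
        exact Sym2.congr_right.1 this
      rw [this, h2]; rfl
    · have : Sym2.Mem.other h1 = u := by
        have := Sym2.other_spec h1
        generalize Sym2.Mem.other h1 = o at this
        rw [h3, Sym2.eq_swap (a := u)] at this
        exact Sym2.congr_right.1 this
      rw [this, h3]; rfl
    · exact absurd (Sym2.mem_iff.1 h1) (by tauto)
    · exact absurd (Sym2.mem_iff.2 (Or.inl h4)) h1
    · exact absurd (Sym2.mem_iff.2 (Or.inr h5)) h1
    · rw [zero_mul]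
  have hf0 (v : V) (hv : v ∈ P) (k : Fin 2) : f v k = 0 := by
    simp only [f]
    split_ifs with h1 h2
    · rw [← h1, hz v hv]; simp
    · rw [← h2, hz v hv]; simp
    · rfl
  rw [mulVec, dotProduct, Fintype.sum_prod_type, Finset.sum_comm]
  refine Finset.sum_congr rfl fun k _ => ?_
  simp only [hterm]
  have hP : ∑ v : {v : V // ¬v ∉ P}, f v k = 0 :=
    Finset.sum_eq_zero fun v _ => hf0 v (not_not.1 v.2) k
  have h := Fintype.sum_subtype_add_sum_subtype (· ∉ P) (f · k)
  rw [hP, add_zero] at h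
  rw [h, Finset.sum_eq_add u w huw (fun v _ hv => by simp [f, hv.1, hv.2])
    (fun h => absurd (Finset.mem_univ u) h) (fun h => absurd (Finset.mem_univ w) h)]
  simp only [f, if_true, if_neg huw.symm]
  ring

/-- The squared length of the segment of `q` between `u` and `w`. -/
def sqLength {V : Type*} (q : V → Plane) (u w : V) : ℝ := ∑ k, (q u k - q w k) ^ 2

theorem sqLength_eq {V : Type*} (q : V → Plane) (u w : V) :
    sqLength q u w = dist (q u) (q w) ^ 2 := by
  rw [EuclideanSpace.dist_sq_eq]
  simp [sqLength, Real.dist_eq, sq_abs]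

theorem Derivation.map_sqLength {V : Type*} (D : Derivation ℚ ℝ ℝ) (q : V → Plane) (u w : V) :
    D (sqLength q u w) = 2 * ∑ k, (q u k - q w k) * (D (q u k) - D (q w k)) := by
  simp only [sqLength, map_sum, D.leibniz_pow, map_sub, Finset.mul_sum]
  refine Finset.sum_congr rfl fun k _ => ?_
  simp only [smul_eq_mul, nsmul_eq_mul]
  push_cast
  ring

/-- A derivation killing the pinned coordinates differentiates edge lengths through the
pinned rigidity matrix. -/
theorem Derivation.map_sqLength_eq_mulVec {V : Type*} [Fintype V] [DecidableEq V]
    {G : SimpleGraph V} {P : Set V} [DecidablePred (· ∈ P)] (D : Derivation ℚ ℝ ℝ)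
    (q : V → Plane) (hD : ∀ v ∈ P, ∀ k, D (q v k) = 0) {e : G.edgeSet} {u w : V}
    (he : (e : Sym2 V) = s(u, w)) :
    D (sqLength q u w) =
      2 * (pinnedRigidityMatrix G P q).mulVec (fun vi => D (q vi.1 vi.2)) e := by
  have h := pinnedRigidityMatrix_mulVec (P := P) q (fun v => WithLp.toLp 2 fun k => D (q v k))
    (fun v hv => by ext k; exact hD v hv k) he
  rw [D.map_sqLength]
  exact congrArg (2 * ·) h.symm

theorem PinnedIsostatic.exists_mulVec_eq {V : Type*} [Fintype V] [DecidableEq V]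
    {G : SimpleGraph V} [DecidableRel G.Adj] {P : Set V} [DecidablePred (· ∈ P)] {p : V → Plane}
    (hiso : PinnedIsostatic G P p) (c : G.edgeSet → ℝ) :
    ∃ z, (pinnedRigidityMatrix G P p).mulVec z = c := by
  have h : LinearMap.range (pinnedRigidityMatrix G P p).mulVecLin = ⊤ := by
    apply Submodule.eq_top_of_finrank_eq
    rw [Module.finrank_fintype_fun_eq_card, hiso.1]
    exact hiso.2
  exact LinearMap.range_eq_top.1 h c

/-- In a generic pinned isostatic framework, the coordinates of the pins and the squared edge
lengths are algebraically independent. -/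
theorem PinnedIsostatic.algebraicIndependent {V : Type*} [Fintype V] [DecidableEq V]
    {G : SimpleGraph V} [DecidableRel G.Adj] {P : Set V} [DecidablePred (· ∈ P)] {p : V → Plane}
    (hiso : PinnedIsostatic G P p) (hgen : IsGenericConfig 2 p) {a b : G.edgeSet → V}
    (hab : ∀ e : G.edgeSet, (e : Sym2 V) = s(a e, b e)) :
    AlgebraicIndependent ℚ (Sum.elim (fun vi : {v // v ∈ P} × Fin 2 => p vi.1 vi.2)
      fun e => sqLength p (a e) (b e)) := by
  refine algebraicIndependent_of_derivation fun c hc => ?_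
  have hE : ∀ e, c (Sum.inr e) = 0 := by
    obtain ⟨z, hz⟩ := hiso.exists_mulVec_eq fun e => c (Sum.inr e)
    obtain ⟨D, hD⟩ := hgen.exists_derivation_eq
      fun vi : V × Fin 2 => if h : vi.1 ∈ P then 0 else z (⟨vi.1, h⟩, vi.2)
    have hP (v : V) (hv : v ∈ P) (k : Fin 2) : D (p v k) = 0 := by
      rw [hD (v, k), dif_pos hv]
    have hF : (fun vi : {v // v ∉ P} × Fin 2 => D (p vi.1 vi.2)) = z := by
      funext ⟨v, k⟩
      rw [hD (v, k), dif_neg v.2]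
    have hDe (e : G.edgeSet) : D (sqLength p (a e) (b e)) = 2 * c (Sum.inr e) := by
      rw [D.map_sqLength_eq_mulVec p hP (hab e), hF, hz]
    have h := hc D
    simp only [Fintype.sum_sum_type, Sum.elim_inl, Sum.elim_inr, hDe] at h
    rw [Finset.sum_eq_zero (fun vi _ => by rw [hP _ vi.1.2, mul_zero]), zero_add,
      Finset.sum_eq_zero_iff_of_nonneg
        (fun e _ => by nlinarith [mul_self_nonneg (c (Sum.inr e))])] at h
    intro e
    have := h e (Finset.mem_univ e)
    nlinarith
  have hPin : ∀ vi, c (Sum.inl vi) = 0 := by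
    obtain ⟨D, hD⟩ := hgen.exists_derivation_eq
      fun vi : V × Fin 2 => if h : vi.1 ∈ P then c (Sum.inl (⟨vi.1, h⟩, vi.2)) else 0
    have h := hc D
    have hP (vi : {v // v ∈ P} × Fin 2) : D (p vi.1 vi.2) = c (Sum.inl vi) := by
      rw [hD (vi.1.1, vi.2), dif_pos vi.1.2]
    simp only [Fintype.sum_sum_type, Sum.elim_inl, Sum.elim_inr, hE, zero_mul,
      Finset.sum_const_zero, add_zero, hP] at h
    rw [Finset.sum_eq_zero_iff_of_nonneg (fun vi _ => mul_self_nonneg _)] at h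
    intro vi
    exact mul_self_eq_zero.1 (h vi (Finset.mem_univ vi))
  funext i
  cases i with
  | inl vi => exact hPin vi
  | inr e => exact hE e

theorem sqLength_eq_of_mem_flexSpace {V : Type*} {G : SimpleGraph V} {P : Set V}
    {p q : V → Plane} {e : Sym2 V} (hq : q ∈ flexSpace G P p e) {e' : G.edgeSet} {u w : V}
    (he' : (e' : Sym2 V) = s(u, w)) (hne : (e' : Sym2 V) ≠ e) :
    sqLength q u w = sqLength p u w := by
  have hadj : s(u, w) ∈ G.edgeSet := he' ▸ e'.2
  rw [sqLength_eq, sqLength_eq, hq.2 hadj (he' ▸ hne)]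

/-- At every point of the flex space, the rows of the pinned rigidity matrix other than the row
of the cut edge are independent. -/
theorem PinnedIsostatic.exists_mulVec_eq_of_mem_flexSpace {V : Type*} [Fintype V] [DecidableEq V]
    {G : SimpleGraph V} [DecidableRel G.Adj] {P : Set V} [DecidablePred (· ∈ P)] {p : V → Plane}
    (hiso : PinnedIsostatic G P p) (hgen : IsGenericConfig 2 p) {e : G.edgeSet} {q : V → Plane}
    (hq : q ∈ flexSpace G P p e) (c : G.edgeSet → ℝ) :
    ∃ z, ∀ e' ≠ e, (pinnedRigidityMatrix G P q).mulVec z e' = c e' := by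
  have hab' (e : G.edgeSet) : ∃ ab : V × V, (e : Sym2 V) = s(ab.1, ab.2) :=
    ⟨Quot.out e.1, (Quot.out_eq e.1).symm⟩
  choose ab hab using hab'
  have hind := (hiso.algebraicIndependent hgen hab).comp
    (fun i : {i // i ≠ Sum.inr e} => i.1) Subtype.val_injective
  have heq : (Sum.elim (fun vi : {v // v ∈ P} × Fin 2 => p vi.1 vi.2)
        fun e => sqLength p (ab e).1 (ab e).2) ∘ (fun i : {i // i ≠ Sum.inr e} => i.1) =
      (Sum.elim (fun vi : {v // v ∈ P} × Fin 2 => q vi.1 vi.2)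
        fun e => sqLength q (ab e).1 (ab e).2) ∘ (fun i : {i // i ≠ Sum.inr e} => i.1) := by
    funext ⟨i, hi⟩
    cases i with
    | inl vi => exact congrArg (fun x : Plane => x vi.2) (hq.1 _ vi.1.2).symm
    | inr e' =>
      exact (sqLength_eq_of_mem_flexSpace hq (hab e')
        fun h => hi (congrArg Sum.inr (Subtype.ext h))).symm
  rw [heq] at hind
  obtain ⟨D, hD⟩ := hind.exists_derivation_eq fun i => Sum.elim 0 (fun e => 2 * c e) i.1
  have hP (v : V) (hv : v ∈ P) (k : Fin 2) : D (q v k) = 0 :=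
    hD ⟨Sum.inl (⟨v, hv⟩, k), Sum.inl_ne_inr⟩
  refine ⟨fun vi => D (q vi.1 vi.2), fun e' he' => ?_⟩
  have h1 := D.map_sqLength_eq_mulVec q hP (hab e')
  have h2 : D (sqLength q (ab e').1 (ab e').2) = 2 * c e' :=
    hD ⟨Sum.inr e', fun h => he' (Sum.inr_injective h)⟩
  linarith

/-- A velocity assignment that fixes the pins and infinitesimally preserves the length of every
edge other than `e`. -/
def IsInfinitesimalFlex {V : Type*} (G : SimpleGraph V) (P : Set V) (e : Sym2 V)
    (q z : V → Plane) : Prop :=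
  (∀ v ∈ P, z v = 0) ∧
    ∀ ⦃u w : V⦄, G.Adj u w → s(u, w) ≠ e → ∑ k, (q u k - q w k) * (z u k - z w k) = 0

/-- The vector field on configurations given by a column of the adjugate of the pinned rigidity
matrix, whose rows are matched with its columns by `σ`. -/
def flexField {V : Type*} [Fintype V] [DecidableEq V] (G : SimpleGraph V) (P : Set V)
    [DecidablePred (· ∈ P)] (σ : G.edgeSet ≃ {v : V // v ∉ P} × Fin 2) (e : G.edgeSet)
    (q : V → Plane) : V → Plane :=
  fun v => WithLp.toLp 2 fun k => if h : v ∈ P then 0 else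
    ((pinnedRigidityMatrix G P q).submatrix σ.symm id).adjugate (⟨v, h⟩, k) (σ e)

theorem contDiff_flexField {V : Type*} [Fintype V] [DecidableEq V] (G : SimpleGraph V)
    (P : Set V) [DecidablePred (· ∈ P)] (σ : G.edgeSet ≃ {v : V // v ∉ P} × Fin 2)
    (e : G.edgeSet) : ContDiff ℝ 1 (flexField G P σ e) := by
  have hR (i j) : ContDiff ℝ 1 fun q : V → Plane =>
      (pinnedRigidityMatrix G P q).submatrix σ.symm id i j := by
    simp only [Matrix.submatrix_apply, pinnedRigidityMatrix]
    split_ifs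
    · simp only [PiLp.sub_apply]
      fun_prop
    · exact contDiff_const
  refine contDiff_pi.2 fun v => contDiff_euclidean.2 fun k => ?_
  simp only [flexField]
  split_ifs with h
  · exact contDiff_const
  · simp only [Matrix.adjugate_apply, Matrix.det_apply]
    refine ContDiff.sum fun τ _ => ContDiff.const_smul _ (contDiff_prod fun i _ => ?_)
    simp only [Matrix.updateRow_apply]
    split_ifs
    · exact contDiff_const
    · exact hR _ _

theorem isInfinitesimalFlex_flexField {V : Type*} [Fintype V] [DecidableEq V]
    {G : SimpleGraph V} {P : Set V} [DecidablePred (· ∈ P)]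
    (σ : G.edgeSet ≃ {v : V // v ∉ P} × Fin 2) (e : G.edgeSet) (q : V → Plane) :
    IsInfinitesimalFlex G P e q (flexField G P σ e q) := by
  have hP : ∀ v ∈ P, flexField G P σ e q v = 0 := fun v hv => by
    ext k
    simp [flexField, hv]
  refine ⟨hP, fun u w huw hne => ?_⟩
  rw [← pinnedRigidityMatrix_mulVec (P := P) q _ hP (e := ⟨s(u, w), huw⟩) rfl]
  let A := (pinnedRigidityMatrix G P q).submatrix σ.symm id
  have h : (A * A.adjugate) (σ ⟨s(u, w), huw⟩) (σ e) = 0 := by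
    rw [Matrix.mul_adjugate, Matrix.smul_apply, Matrix.one_apply_ne, smul_zero]
    exact fun h => hne (congrArg Subtype.val (σ.injective h))
  rw [Matrix.mul_apply] at h
  rw [Matrix.mulVec, dotProduct, ← h]
  refine Finset.sum_congr rfl fun vi _ => ?_
  simp [A, flexField, vi.1.2]

theorem PinnedIsostatic.flexField_ne_zero_and_spans {V : Type*} [Fintype V] [DecidableEq V]
    {G : SimpleGraph V} [DecidableRel G.Adj] {P : Set V} [DecidablePred (· ∈ P)] {p : V → Plane}
    (hiso : PinnedIsostatic G P p) (hgen : IsGenericConfig 2 p) {e : G.edgeSet} {q : V → Plane}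
    (hq : q ∈ flexSpace G P p e) (σ : G.edgeSet ≃ {v : V // v ∉ P} × Fin 2) :
    flexField G P σ e q ≠ 0 ∧
      ∀ z, IsInfinitesimalFlex G P e q z → ∃ t : ℝ, z = t • flexField G P σ e q := by
  let A := (pinnedRigidityMatrix G P q).submatrix σ.symm id
  have hA (y) (i) : A.mulVec y i = (pinnedRigidityMatrix G P q).mulVec y (σ.symm i) := rfl
  obtain ⟨h0, hspan⟩ := A.adjugate_col_spans_ker (σ e) fun c => by
    obtain ⟨z, hz⟩ := hiso.exists_mulVec_eq_of_mem_flexSpace hgen hq (c ∘ σ)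
    refine ⟨z, fun i hi => ?_⟩
    rw [hA, hz _ fun h => hi (by rw [← h, σ.apply_symm_apply]), Function.comp_apply,
      σ.apply_symm_apply]
  have hX (v : {v // v ∉ P}) (k) : flexField G P σ e q v k = A.adjugate (v, k) (σ e) := by
    simp [flexField, A, v.2]
  constructor
  · refine fun h => h0 (funext fun ⟨v, k⟩ => ?_)
    rw [← hX, h]
    rfl
  · intro z hz
    obtain ⟨t, ht⟩ := hspan (fun vi => z vi.1 vi.2) fun i hi => by
      obtain ⟨⟨s, hs⟩, rfl⟩ := σ.surjective i
      rw [hA, σ.symm_apply_apply]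
      induction s with | _ u w
      rw [pinnedRigidityMatrix_mulVec q z hz.1 rfl]
      exact hz.2 hs fun h => hi (congrArg σ (Subtype.ext h))
    refine ⟨t, funext fun v => ?_⟩
    by_cases hv : v ∈ P
    · rw [Pi.smul_apply, hz.1 v hv, (isInfinitesimalFlex_flexField σ e q).1 v hv, smul_zero]
    · ext k
      rw [Pi.smul_apply, PiLp.smul_apply, hX ⟨v, hv⟩ k]
      exact congrFun ht (⟨v, hv⟩, k)

/-- The pin positions and squared lengths of the edges other than `e`. -/
def measurement {V : Type*} (G : SimpleGraph V) (P : Set V) (e : Sym2 V) (q : V → Plane) :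
    ({uw : V × V // G.Adj uw.1 uw.2 ∧ s(uw.1, uw.2) ≠ e} → ℝ) × ({v // v ∈ P} → Plane) :=
  (fun uw => sqLength q uw.1.1 uw.1.2, fun v => q v)

theorem contDiff_measurement {V : Type*} [Fintype V] (G : SimpleGraph V) (P : Set V)
    (e : Sym2 V) [Fintype {uw : V × V // G.Adj uw.1 uw.2 ∧ s(uw.1, uw.2) ≠ e}]
    [Fintype {v // v ∈ P}] : ContDiff ℝ 1 (measurement G P e) := by
  refine ContDiff.prodMk (contDiff_pi.2 fun uw => ?_) (contDiff_pi.2 fun v => by fun_prop)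
  simp only [sqLength]
  fun_prop

theorem flexSpace_eq_preimage_measurement {V : Type*} (G : SimpleGraph V) (P : Set V)
    (p : V → Plane) (e : Sym2 V) :
    flexSpace G P p e = measurement G P e ⁻¹' {measurement G P e p} := by
  ext q
  simp only [flexSpace, measurement, Set.mem_ofPred_eq, Set.mem_preimage,
    Set.mem_singleton_iff, Prod.mk.injEq,
    funext_iff, Subtype.forall, Prod.forall, sqLength_eq, and_imp]
  rw [and_comm]
  refine and_congr (forall₂_congr fun u w => forall₂_congr fun _ _ => ?_) Iff.rfl
  exact (sq_eq_sq₀ dist_nonneg dist_nonneg).symm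

theorem fderiv_measurement_eq_zero_iff {V : Type*} [Fintype V] (G : SimpleGraph V) (P : Set V)
    (e : Sym2 V) [Fintype {uw : V × V // G.Adj uw.1 uw.2 ∧ s(uw.1, uw.2) ≠ e}]
    [Fintype {v // v ∈ P}] (q z : V → Plane) :
    fderiv ℝ (measurement G P e) q z = 0 ↔ IsInfinitesimalFlex G P e q z := by
  have hline : HasDerivAt (fun t : ℝ => measurement G P e (q + t • z))
      (fun uw => 2 * ∑ k, (q uw.1.1 k - q uw.1.2 k) * (z uw.1.1 k - z uw.1.2 k),
        fun v => z v) 0 := by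
    refine HasDerivAt.prodMk (hasDerivAt_pi.2 fun uw => ?_) (hasDerivAt_pi.2 fun v => ?_)
    · have h (k : Fin 2) : HasDerivAt
          (fun t : ℝ => ((q + t • z) uw.1.1 k - (q + t • z) uw.1.2 k) ^ 2)
          (2 * ((q uw.1.1 k - q uw.1.2 k) * (z uw.1.1 k - z uw.1.2 k))) 0 := by
        have h1 : HasDerivAt (fun t : ℝ => (q uw.1.1 k - q uw.1.2 k) +
            t * (z uw.1.1 k - z uw.1.2 k)) (z uw.1.1 k - z uw.1.2 k) 0 := by
          simpa using ((hasDerivAt_id (0 : ℝ)).mul_const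
            (z uw.1.1 k - z uw.1.2 k)).const_add (q uw.1.1 k - q uw.1.2 k)
        have hfun : (fun t : ℝ => ((q + t • z) uw.1.1 k - (q + t • z) uw.1.2 k) ^ 2) =
            (fun t : ℝ => (q uw.1.1 k - q uw.1.2 k) + t * (z uw.1.1 k - z uw.1.2 k)) ^ 2 := by
          funext t
          simp only [Pi.add_apply, Pi.smul_apply, PiLp.add_apply, PiLp.smul_apply, smul_eq_mul,
            Pi.pow_apply]
          ring
        rw [hfun]
        exact (h1.pow 2).congr_deriv (by norm_num; ring)
      rw [Finset.mul_sum]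
      exact HasDerivAt.fun_sum fun k _ => h k
    · simpa using ((hasDerivAt_id (0 : ℝ)).smul_const (z v)).const_add (q v)
  have hd : HasFDerivAt (measurement G P e) (fderiv ℝ (measurement G P e) q) q :=
    ((contDiff_measurement G P e).differentiable one_ne_zero q).hasFDerivAt
  have hline' := hd.hasLineDerivAt z
  rw [(hline'.unique hline : _ = _), Prod.mk_eq_zero, and_comm, IsInfinitesimalFlex]
  simp only [funext_iff, Subtype.forall, Prod.forall, and_imp, Pi.zero_apply, mul_eq_zero,
    two_ne_zero, false_or]

theorem PinnedIsostatic.isBounded_flexSpace {V : Type*} [Fintype V] [DecidableEq V]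
    {G : SimpleGraph V} [DecidableRel G.Adj] {P : Set V} [DecidablePred (· ∈ P)] {p : V → Plane}
    (hiso : PinnedIsostatic G P p) (hgen : IsGenericConfig 2 p) (e : G.edgeSet)
    (σ : G.edgeSet ≃ {v : V // v ∉ P} × Fin 2) :
    Bornology.IsBounded (flexSpace G P p e) := by
  let S : Set V := {v | ∃ C : ℝ, ∀ q ∈ flexSpace G P p e, ‖q v‖ ≤ C}
  have hPS (v) (hv : v ∈ P) : v ∈ S := ⟨‖p v‖, fun q hq => by rw [hq.1 v hv]⟩
  have hstep (u w) (huw : G.Adj u w) (hne : s(u, w) ≠ (e : Sym2 V)) (hu : u ∈ S) : w ∈ S := by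
    obtain ⟨C, hC⟩ := hu
    refine ⟨C + dist (p u) (p w), fun q hq => ?_⟩
    have h1 := hq.2 huw hne
    have h2 : ‖q w‖ ≤ ‖q u‖ + dist (q u) (q w) := by
      rw [dist_eq_norm]
      simpa using norm_sub_le (q u) (q u - q w)
    linarith [hC q hq]
  have hS (v : V) : v ∈ S := by
    by_contra hv
    classical
    let z : Fin 2 → V → Plane := fun k w => if w ∈ S then 0 else PiLp.single 2 k 1
    have hz (k : Fin 2) : IsInfinitesimalFlex G P e p (z k) := by
      refine ⟨fun w hw => if_pos (hPS w hw), fun u w huw hne => ?_⟩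
      have hiff : u ∈ S ↔ w ∈ S :=
        ⟨hstep u w huw hne, hstep w u huw.symm (by rwa [Sym2.eq_swap])⟩
      have : z k u = z k w := by simp [z, hiff]
      simp [this]
    obtain ⟨-, hspan⟩ := hiso.flexField_ne_zero_and_spans hgen
      (q := p) (e := e) ⟨fun _ _ => rfl, fun _ _ _ _ => rfl⟩ σ
    obtain ⟨s, hs⟩ := hspan _ (hz 0)
    obtain ⟨t, ht⟩ := hspan _ (hz 1)
    have hzv (k) : z k v = PiLp.single 2 k 1 := if_neg hv
    have h00 := congrArg (fun x : Plane => x 0) (congrFun hs v)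
    have h01 := congrArg (fun x : Plane => x 1) (congrFun hs v)
    have h11 := congrArg (fun x : Plane => x 1) (congrFun ht v)
    simp only [hzv, Pi.smul_apply, PiLp.smul_apply, smul_eq_mul,
      PiLp.single_apply] at h00 h01 h11
    norm_num at h00 h01 h11
    rcases h01 with h | h
    · simp [h] at h00
    · simp [h] at h11
  choose C hC using hS
  refine isBounded_iff_forall_norm_le.2 ⟨∑ v, |C v|, fun q hq => ?_⟩
  refine (pi_norm_le_iff_of_nonneg (Finset.sum_nonneg fun v _ => abs_nonneg _)).2 fun v => ?_
  exact ((hC v q hq).trans (le_abs_self _)).trans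
    (Finset.single_le_sum (f := fun v => |C v|) (fun v _ => abs_nonneg _) (Finset.mem_univ v))

/-- Removing a single edge from a generic pinned isostatic framework in the plane
(with at least three pins) yields a configuration space that is a nonempty compact
topological 1-manifold, each connected component of which is homeomorphic to the
circle. -/
theorem single_cut_configuration_space_is_union_of_circles
    {V : Type*} [Fintype V] [DecidableEq V] (G : SimpleGraph V) [DecidableRel G.Adj]
    (P : Set V) [DecidablePred (· ∈ P)] (hP : 3 ≤ P.ncard)
    (p : V → Plane) (hgen : IsGenericConfig 2 p) (hiso : PinnedIsostatic G P p)
    (e : Sym2 V) (he : e ∈ G.edgeSet) :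
    (flexSpace G P p e).Nonempty ∧
    IsCompact (flexSpace G P p e) ∧
    Nonempty (ChartedSpace (EuclideanSpace ℝ (Fin 1)) (flexSpace G P p e)) ∧
    ∀ x : flexSpace G P p e,
      Nonempty ((connectedComponent x : Set (flexSpace G P p e)) ≃ₜ Circle) := by
  classical
  lift e to G.edgeSet using he
  have hcard : Fintype.card G.edgeSet = Fintype.card ({v : V // v ∉ P} × Fin 2) := by
    rw [hiso.1, Fintype.card_prod, Fintype.card_fin, mul_comm]
  let σ := Fintype.equivOfCardEq hcard
  have hcpt : IsCompact (flexSpace G P p e) := by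
    refine Metric.isCompact_of_isClosed_isBounded ?_ (hiso.isBounded_flexSpace hgen e σ)
    rw [flexSpace_eq_preimage_measurement]
    exact isClosed_singleton.preimage (contDiff_measurement G P e).continuous
  have hcomp (x : flexSpace G P p e) :
      IsOpen (connectedComponent x) ∧ Nonempty (connectedComponent x ≃ₜ Circle) := by
    have hmem {q} (hq : q ∈ measurement G P e ⁻¹' {measurement G P e p}) :
        q ∈ flexSpace G P p e := by
      rwa [flexSpace_eq_preimage_measurement]
    have h := connectedComponent_homeomorph_circle_of_levelSet (contDiff_measurement G P e)
      (contDiff_flexField G P σ e) (flexSpace_eq_preimage_measurement G P p e ▸ hcpt)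
      (fun q => (fderiv_measurement_eq_zero_iff G P e q _).2
        (isInfinitesimalFlex_flexField σ e q))
      (fun q hq z hz => (hiso.flexField_ne_zero_and_spans hgen (hmem hq) σ).2 z
        ((fderiv_measurement_eq_zero_iff G P e q z).1 hz))
      (fun q hq => (hiso.flexField_ne_zero_and_spans hgen (hmem hq) σ).1)
    rw [← flexSpace_eq_preimage_measurement] at h
    exact h x
  exact ⟨⟨p, fun _ _ => rfl, fun _ _ _ _ => rfl⟩, hcpt,
    nonempty_chartedSpace_of_isOpen_homeomorph hcomp, fun x => (hcomp x).2⟩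
end
end
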